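/- Proper geodesic space: let (X,d,m,G) be a gauge metric measure space satisfying MCP(β) for a distortion coefficient β as in the context. Assume that every bounded subset of supp m is G-bounded, or that θ ↦ β_t(θ) is non-decreasing for every t ∈ [0,1]. Then (supp m, d) is a proper geodesic metric space: every closed bounded subset of supp m is compact, and any two points of supp m are joined by a geodesic contained in supp m. -/

import Mathlib

open MeasureTheory Filter Set Metric ENNReal Topology

noncomputable section

namespace GMMS

variable {X : Type*}

open Classical in
/-- The support of a Borel measure on a metric space: points all of whose balls have
positive measure. -/
def mSupp [PseudoMetricSpace X] [MeasurableSpace X] (m : Measure X) : Set X :=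
  {x : X | ∀ r : ℝ, 0 < r → 0 < m (Metric.ball x r)}

/-- A measure which is finite on every bounded set. -/
def FiniteOnBounded [PseudoMetricSpace X] [MeasurableSpace X] (m : Measure X) : Prop :=
  ∀ s : Set X, Bornology.IsBounded s → m s < ⊤

open Classical in
/-- The nonnegative part of an extended real number, in `[0,∞]`. -/
def epos (x : EReal) : ℝ≥0∞ := if x = ⊤ then ⊤ else ENNReal.ofReal x.toReal

/-- Integral of an `EReal`-valued function, defined as the difference of the lower integrals of
the positive and negative parts (with the `EReal` convention `⊤ - ⊤ = ⊥`). -/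
def eintegral {α : Type*} [MeasurableSpace α] (ν : Measure α) (f : α → EReal) : EReal :=
  ((∫⁻ a, epos (f a) ∂ν : ℝ≥0∞) : EReal) - ((∫⁻ a, epos (-(f a)) ∂ν : ℝ≥0∞) : EReal)

/-- `𝒟 = inf {θ > 0 | s θ = 0} ∈ (0,+∞]`. -/
def Dcal (s : ℝ → ℝ) : ℝ≥0∞ :=
  sInf (ENNReal.ofReal '' {θ : ℝ | 0 < θ ∧ s θ = 0})

/-- The distortion coefficient `β` associated with the data `(s, N)`:
`β t 0 = t ^ N`, `β t θ = s (t θ) / s θ` for `0 < θ < 𝒟`, and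
`β t θ = liminf_{φ → 𝒟⁻} s (t φ) / s φ` for `θ ≥ 𝒟`. -/
def beta (s : ℝ → ℝ) (N : ℝ) (t : ℝ) (θ : ℝ≥0∞) : ℝ≥0∞ :=
  if θ = 0 then ENNReal.ofReal (t ^ N)
  else if θ < Dcal s then ENNReal.ofReal (s (t * θ.toReal) / s θ.toReal)
  else Filter.liminf (fun φ : ℝ≥0∞ => ENNReal.ofReal (s (t * φ.toReal) / s φ.toReal))
      (nhdsWithin (Dcal s) (Set.Iio (Dcal s)))

open Classical in
/-- The data `(s, N)` defining a distortion coefficient: `N ∈ [1,∞)`, `s` continuous on `[0,∞)`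
with `s θ = c θ^N + o(θ^N)` as `θ → 0⁺`, for some `c > 0`. -/
structure DistortionData (s : ℝ → ℝ) (N : ℝ) : Prop where
  one_le : 1 ≤ N
  cont : ContinuousOn s (Set.Ici 0)
  asymp : ∃ c : ℝ, 0 < c ∧
    (fun θ : ℝ => s θ - c * θ ^ N) =o[nhdsWithin 0 (Set.Ioi 0)] (fun θ : ℝ => θ ^ N)

/-- The space of (constant-speed, defined on `[0,1]`) geodesics of a metric space. -/
abbrev GeoSpace (X : Type*) [MetricSpace X] : Type _ :=
  {γ : C(unitInterval, X) //
    ∀ s t : unitInterval, dist (γ s) (γ t) = |(s : ℝ) - (t : ℝ)| * dist (γ 0) (γ 1)}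

instance [MetricSpace X] : MeasurableSpace (GeoSpace X) := borel _

/-- Evaluation of a geodesic at time `t ∈ [0,1]`. -/
def geval [MetricSpace X] (γ : GeoSpace X) (t : ℝ) : X :=
  γ.1 (Set.projIcc 0 1 zero_le_one t)

/-- The squared quadratic Kantorovich-Rubinstein-Wasserstein transportation cost. -/
def W2sq [MetricSpace X] [MeasurableSpace X] (μ ν : Measure X) : ℝ≥0∞ :=
  ⨅ (π : Measure (X × X)) (_ : π.map Prod.fst = μ) (_ : π.map Prod.snd = ν),
    ∫⁻ p, edist p.1 p.2 ^ 2 ∂π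

/-- A `W₂`-geodesic: a curve of probability measures with finite second moment such that
`W₂(μ_s, μ_t) = |s - t| W₂(μ_0, μ_1)`. -/
structure IsW2Geo [MetricSpace X] [MeasurableSpace X] (μ : ℝ → Measure X) : Prop where
  prob : ∀ t ∈ Set.Icc (0:ℝ) 1, IsProbabilityMeasure (μ t)
  moment : ∀ t ∈ Set.Icc (0:ℝ) 1, ∃ x₀ : X, ∫⁻ x, edist x x₀ ^ 2 ∂(μ t) < ⊤
  geo : ∀ s ∈ Set.Icc (0:ℝ) 1, ∀ t ∈ Set.Icc (0:ℝ) 1,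
    W2sq (μ s) (μ t) = ENNReal.ofReal ((s - t) ^ 2) * W2sq (μ 0) (μ 1)

/-- Optimal dynamical plans from `μ0` to `μ1`. -/
def OptGeoSet [MetricSpace X] [MeasurableSpace X] (μ0 μ1 : Measure X) :
    Set (Measure (GeoSpace X)) :=
  {ν | IsProbabilityMeasure ν ∧
    (ν.map fun γ => (geval γ 0, geval γ 1)).map Prod.fst = μ0 ∧
    (ν.map fun γ => (geval γ 0, geval γ 1)).map Prod.snd = μ1 ∧
    ∫⁻ p, edist p.1 p.2 ^ 2 ∂(ν.map fun γ => (geval γ 0, geval γ 1)) = W2sq μ0 μ1}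

open Classical in
/-- The Boltzmann-Shannon relative entropy `Ent(μ|m) = ∫ ρ log ρ dm` if `μ = ρ m` with
`ρ log ρ ∈ L¹(m)`, and `+∞` otherwise. -/
def Ent [MeasurableSpace X] (μ m : Measure X) : EReal :=
  if μ ≪ m ∧
      Integrable (fun x => (μ.rnDeriv m x).toReal * Real.log (μ.rnDeriv m x).toReal) m
  then ((∫ x, (μ.rnDeriv m x).toReal * Real.log (μ.rnDeriv m x).toReal ∂m : ℝ) : EReal)
  else (⊤ : EReal)

/-- The dimensional entropy `U_n(μ|m) = exp (-Ent(μ|m)/n)`, with value `0` when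
`Ent(μ|m) = +∞`. -/
def UnE [MeasurableSpace X] (n : ℝ) (μ m : Measure X) : ℝ≥0∞ :=
  EReal.exp (((n⁻¹ : ℝ) : EReal) * (-(Ent μ m)))

/-- Probability measures with bounded support contained in `supp m`. -/
def Pbs [MetricSpace X] [MeasurableSpace X] (m : Measure X) : Set (Measure X) :=
  {μ | IsProbabilityMeasure μ ∧ Bornology.IsBounded (mSupp μ) ∧ mSupp μ ⊆ mSupp m}

/-- Probability measures with bounded support contained in `supp m` and finite entropy. -/
def PbsStar [MetricSpace X] [MeasurableSpace X] (m : Measure X) : Set (Measure X) :=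
  {μ | μ ∈ Pbs m ∧ Ent μ m ≠ ⊤}

/-- The coefficient `exp ((1/n) ∫ log (f γ) dν(γ))` appearing in the `CD(β,n)` inequality. -/
def cdCoeff [MetricSpace X] (n : ℝ) (ν : Measure (GeoSpace X)) (f : GeoSpace X → ℝ≥0∞) :
    ℝ≥0∞ :=
  EReal.exp (((n⁻¹ : ℝ) : EReal) * eintegral ν fun γ => ENNReal.log (f γ))

/-- The `CD` convexity inequality along the dynamical plan `ν`, for a coefficient
`b : [0,1] × [0,∞] → [0,∞]` (with the conventions `∞ ⬝ 0 = 0` of `ℝ≥0∞`). -/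
def CDineq [MetricSpace X] [MeasurableSpace X] (m : Measure X) (G : X → X → ℝ≥0∞)
    (b : ℝ → ℝ≥0∞ → ℝ≥0∞) (n : ℝ) (μ0 μ1 : Measure X) (ν : Measure (GeoSpace X)) : Prop :=
  ∀ t ∈ Set.Ioo (0:ℝ) 1,
    cdCoeff n ν (fun γ => b (1 - t) (G (geval γ 1) (geval γ 0))) * UnE n μ0 m
      + cdCoeff n ν (fun γ => b t (G (geval γ 0) (geval γ 1))) * UnE n μ1 m
      ≤ UnE n (ν.map fun γ => geval γ t) m

/-- The curvature-dimension condition `CD(b, n)` for the gauge metric measure space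
`(X, d, m, G)`. -/
def CD [MetricSpace X] [MeasurableSpace X] (m : Measure X) (G : X → X → ℝ≥0∞)
    (b : ℝ → ℝ≥0∞ → ℝ≥0∞) (n : ℝ) : Prop :=
  ∀ μ0 ∈ Pbs m, ∀ μ1 ∈ PbsStar m, mSupp μ0 ∩ mSupp μ1 = ∅ →
    ∃ ν ∈ OptGeoSet μ0 μ1, CDineq m G b n μ0 μ1 ν

/-- The strong curvature-dimension condition: the `CD` inequality holds along every
optimal dynamical plan. -/
def CDStrong [MetricSpace X] [MeasurableSpace X] (m : Measure X) (G : X → X → ℝ≥0∞)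
    (b : ℝ → ℝ≥0∞ → ℝ≥0∞) (n : ℝ) : Prop :=
  ∀ μ0 ∈ Pbs m, ∀ μ1 ∈ PbsStar m, mSupp μ0 ∩ mSupp μ1 = ∅ →
    ∀ ν ∈ OptGeoSet μ0 μ1, CDineq m G b n μ0 μ1 ν

/-- The measure contraction property `MCP(b)` for the gauge metric measure space
`(X, d, m, G)`. -/
def MCP [MetricSpace X] [MeasurableSpace X] (m : Measure X) (G : X → X → ℝ≥0∞)
    (b : ℝ → ℝ≥0∞ → ℝ≥0∞) : Prop :=
  ∀ x ∈ mSupp m, ∀ μ1 ∈ PbsStar m, x ∉ mSupp μ1 →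
    ∃ μ : ℝ → Measure X, IsW2Geo μ ∧ μ 0 = Measure.dirac x ∧ μ 1 = μ1 ∧
      ∀ t ∈ Set.Ioo (0:ℝ) 1, ∀ n : ℝ, 1 ≤ n →
        EReal.exp (((n⁻¹ : ℝ) : EReal) * eintegral μ1 fun y => ENNReal.log (b t (G x y)))
            * UnE n μ1 m
          ≤ UnE n (μ t) m

/-- The set of `t`-intermediate points between `A0` and `A1`. -/
def Zt [MetricSpace X] (t : ℝ) (A0 A1 : Set X) : Set X :=
  {x | ∃ γ : GeoSpace X, geval γ 0 ∈ A0 ∧ geval γ 1 ∈ A1 ∧ geval γ t = x}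

/-- The distortion coefficient `β_t(A0, A1)` between two sets. -/
def betaSet [MetricSpace X] [MeasurableSpace X] (m : Measure X) (G : X → X → ℝ≥0∞)
    (b : ℝ≥0∞ → ℝ≥0∞) (A0 A1 : Set X) : ℝ≥0∞ :=
  ⨆ (A0' : Set X) (_ : A0' ⊆ A0) (_ : A0'.Nonempty) (_ : m (A0 \ A0') = 0)
    (A1' : Set X) (_ : A1' ⊆ A1) (_ : A1'.Nonempty) (_ : m (A1 \ A1') = 0),
    ⨅ (x0 : X) (_ : x0 ∈ A0' ∩ mSupp m) (x1 : X) (_ : x1 ∈ A1' ∩ mSupp m), b (G x0 x1)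

/-- The "true" distortion coefficient of a metric measure space. -/
def trueBeta [MetricSpace X] [MeasurableSpace X] (m : Measure X) (t : ℝ) (x y : X) : ℝ≥0∞ :=
  Filter.limsup (fun r : ℝ => m (Zt t {x} (Metric.ball y r)) / m (Metric.ball y r))
    (nhdsWithin 0 (Set.Ioi 0))

/-- The `G`-diameter of a set. -/
def diamG [MetricSpace X] [MeasurableSpace X] (m : Measure X) (G : X → X → ℝ≥0∞)
    (S : Set X) : ℝ≥0∞ :=
  ⨆ x ∈ S, essSup (fun y => G x y) (m.restrict (S \ {x}))

/-- The quantity `C_σ(x)` entering the definition of the geodesic dimension. -/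
def Csig [MetricSpace X] [MeasurableSpace X] (m : Measure X) (σ : ℝ) (x : X) : ℝ≥0∞ :=
  ⨆ (A : Set X) (_ : MeasurableSet A) (_ : Bornology.IsBounded A) (_ : x ∉ A)
    (_ : 0 < m A) (_ : m A < ⊤),
    Filter.limsup (fun t : ℝ => ENNReal.ofReal (t ^ (-σ)) * m (Zt t {x} A) / m A)
      (nhdsWithin 0 (Set.Ioi 0))

/-- The geodesic dimension at a point. -/
def dimGeo [MetricSpace X] [MeasurableSpace X] (m : Measure X) (x : X) : ℝ≥0∞ :=
  sInf (ENNReal.ofReal '' {σ : ℝ | 0 < σ ∧ Csig m σ x = ⊤})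

/-- The geodesic dimension of a set. -/
def dimGeoS [MetricSpace X] [MeasurableSpace X] (m : Measure X) (S : Set X) : ℝ≥0∞ :=
  ⨆ x ∈ S, dimGeo m x

/-- The gauge `G` is meek. -/
def Meek [MetricSpace X] [MeasurableSpace X] (m : Measure X) (G : X → X → ℝ≥0∞) : Prop :=
  ∀ x ∈ mSupp m, ∀ μ1 ∈ PbsStar m, x ∉ mSupp μ1 →
    ∀ ν ∈ OptGeoSet (Measure.dirac x) μ1,
      ∃ Γ : Set (GeoSpace X), MeasurableSet Γ ∧ ν Γ = 1 ∧
        ∀ γ ∈ Γ, ∀ t ∈ Set.Ioc (0:ℝ) 1,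
          G (geval γ 0) (geval γ t) = ENNReal.ofReal t * G (geval γ 0) (geval γ 1)

/-- The measure `v_G(x₀, r, ρ)` of the intersection of a gauge sublevel set with a metric
ball. -/
def vG [MetricSpace X] [MeasurableSpace X] (m : Measure X) (G : X → X → ℝ≥0∞)
    (x0 : X) (r ρ : ℝ) : ℝ≥0∞ :=
  m {x | G x0 x ≤ ENNReal.ofReal r ∧ dist x0 x ≤ ρ}

/-- `(supp m, d)` is a geodesic space: any two points of the support are joined by a geodesic
contained in the support. -/
def GeodesicSupp [MetricSpace X] [MeasurableSpace X] (m : Measure X) : Prop :=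
  ∀ x ∈ mSupp m, ∀ y ∈ mSupp m, ∃ γ : GeoSpace X,
    geval γ 0 = x ∧ geval γ 1 = y ∧ ∀ t ∈ Set.Icc (0:ℝ) 1, geval γ t ∈ mSupp m

section Transport

variable [MetricSpace X]

/-- Points of approximate `t`-intermediate position between `x` and a point of `E`, up to an
error of size `η`. -/
def approxIntermediate (x : X) (E : Set X) (t η : ℝ) : Set X :=
  {z | ∃ y ∈ E, dist x z < t * dist x y + 2 * η ∧ dist z y < (1 - t) * dist x y + 2 * η}

theorem isOpen_approxIntermediate (x : X) (E : Set X) (t η : ℝ) :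
    IsOpen (approxIntermediate x E t η) := by
  have h : approxIntermediate x E t η = ⋃ y ∈ E,
      ({z | dist x z < t * dist x y + 2 * η} ∩ {z | dist z y < (1 - t) * dist x y + 2 * η}) := by
    ext z
    simp only [approxIntermediate, mem_ofPred_eq, mem_iUnion, mem_inter_iff, exists_prop]
  rw [h]
  refine isOpen_biUnion fun y _ => IsOpen.inter ?_ ?_
  · exact isOpen_lt (by fun_prop) (by fun_prop)
  · exact isOpen_lt (by fun_prop) (by fun_prop)

/-- If the weighted energy of a broken path nearly agrees with that of a straight one, then the
break point is nearly `t`-intermediate. -/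
theorem lt_of_energy_gap_lt {a b D t η : ℝ} (ha : 0 ≤ a) (hb : 0 ≤ b) (hD : 0 ≤ D)
    (ht : t ∈ Ioo (0 : ℝ) 1) (hη : 0 < η) (hgap : a ^ 2 / t + b ^ 2 / (1 - t) < D ^ 2 + η ^ 2)
    (htri : D ≤ a + b) : a < t * D + 2 * η ∧ b < (1 - t) * D + 2 * η := by
  obtain ⟨ht0, ht1⟩ := ht
  have ht1' : 0 < 1 - t := by linarith
  set u := (1 - t) * a - t * b with hu
  have hid : a ^ 2 / t + b ^ 2 / (1 - t) = (a + b) ^ 2 + u ^ 2 / (t * (1 - t)) := by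
    rw [hu]
    field_simp
    ring
  have hu0 : 0 ≤ u ^ 2 / (t * (1 - t)) := by positivity
  have hu2 : u ^ 2 ≤ u ^ 2 / (t * (1 - t)) := by
    rw [le_div_iff₀ (by positivity)]
    exact mul_le_of_le_one_right (sq_nonneg u) (by nlinarith)
  have hsum : a + b < D + η := by
    apply lt_of_pow_lt_pow_left₀ 2 (by positivity)
    nlinarith
  have huη : |u| < η := by
    apply abs_lt_of_sq_lt_sq _ hη.le
    nlinarith
  obtain ⟨h1, h2⟩ := abs_lt.1 huη
  constructor
  · have : a = t * (a + b) + u := by rw [hu]; ring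
    nlinarith
  · have : b = (1 - t) * (a + b) - u := by rw [hu]; ring
    nlinarith

variable [MeasurableSpace X] [BorelSpace X] [SecondCountableTopology X]

theorem W2sq_dirac_le (x : X) (ν : Measure X) [IsProbabilityMeasure ν] :
    W2sq (Measure.dirac x) ν ≤ ∫⁻ y, edist x y ^ 2 ∂ν := by
  have hmeas : Measurable fun y : X => (x, y) := by fun_prop
  unfold W2sq
  refine iInf_le_of_le (ν.map fun y => (x, y)) (iInf_le_of_le ?_ (iInf_le_of_le ?_ ?_))
  · rw [Measure.map_map measurable_fst hmeas]
    change ν.map (fun _ => x) = _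
    rw [Measure.map_const]
    simp
  · rw [Measure.map_map measurable_snd hmeas]
    exact Measure.map_id
  · rw [lintegral_map (by fun_prop) hmeas]

theorem le_W2sq_dirac (x : X) (ν : Measure X) :
    ∫⁻ y, edist x y ^ 2 ∂ν ≤ W2sq (Measure.dirac x) ν := by
  refine le_iInf fun π => le_iInf fun h1 => le_iInf fun h2 => ?_
  have hx : ∀ᵐ p ∂π, p.1 = x := by
    have : ∀ᵐ z ∂(π.map Prod.fst), z = x := by
      rw [h1]
      exact (ae_dirac_iff (measurableSet_singleton x)).2 rfl
    exact ae_of_ae_map measurable_fst.aemeasurable this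
  rw [← h2, lintegral_map (by fun_prop) measurable_snd]
  refine le_of_eq (lintegral_congr_ae ?_)
  filter_upwards [hx] with p hp
  rw [hp]

/-- Along a `W₂`-geodesic issuing from a Dirac mass, the intermediate measures are concentrated
on approximate intermediate points. -/
theorem IsW2Geo.measure_compl_approxIntermediate {μ : ℝ → Measure X} (hμ : IsW2Geo μ) {x : X}
    (h0 : μ 0 = Measure.dirac x) {E : Set X} (hE : ∀ᵐ y ∂(μ 1), y ∈ E)
    (hbdd : Bornology.IsBounded E) {t η : ℝ} (ht : t ∈ Ioo (0 : ℝ) 1) (hη : 0 < η) :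
    μ t (approxIntermediate x E t η)ᶜ = 0 := by
  have ht0 : 0 < t := ht.1
  have ht1 : 0 < 1 - t := by linarith [ht.2]
  have htI : t ∈ Icc (0 : ℝ) 1 := ⟨ht.1.le, ht.2.le⟩
  have hprob1 : IsProbabilityMeasure (μ 1) := hμ.prob 1 (by simp)
  set A := approxIntermediate x E t η with hA
  have hAm : MeasurableSet Aᶜ := (isOpen_approxIntermediate x E t η).measurableSet.compl
  set W := W2sq (μ 0) (μ 1) with hW
  set I := ∫⁻ y, edist x y ^ 2 ∂(μ 1) with hI
  have hWI : W ≤ I := by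
    rw [hW, h0]
    exact W2sq_dirac_le x (μ 1)
  have hIfin : I < ⊤ := by
    obtain ⟨R, hR⟩ := hbdd.subset_closedBall x
    calc I ≤ ∫⁻ _, ENNReal.ofReal R ^ 2 ∂(μ 1) := by
          refine lintegral_mono_ae ?_
          filter_upwards [hE] with y hy
          gcongr
          rw [edist_comm, edist_dist]
          exact ENNReal.ofReal_le_ofReal (hR hy)
      _ < ⊤ := by simp
  have hWfin : W < ⊤ := hWI.trans_lt hIfin
  have hlim : ∀ ε : ℝ≥0∞, 0 < ε → ENNReal.ofReal (η ^ 2) * μ t Aᶜ ≤ ENNReal.ofReal (1 - t)⁻¹ * ε := by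
    intro ε hε
    have hlt : W2sq (μ t) (μ 1) < ENNReal.ofReal ((1 - t) ^ 2) * W + ε := by
      rw [hμ.geo t htI 1 (by simp), show (t - 1) ^ 2 = (1 - t) ^ 2 by ring]
      exact ENNReal.lt_add_right (ENNReal.mul_ne_top ENNReal.ofReal_ne_top hWfin.ne) hε.ne'
    unfold W2sq at hlt
    simp only [iInf_lt_iff] at hlt
    obtain ⟨π, h1, h2, hπ⟩ := hlt
    have hmt : ∫⁻ z, edist x z ^ 2 ∂(μ t) ≤ ENNReal.ofReal (t ^ 2) * W := by
      refine (le_W2sq_dirac x (μ t)).trans (le_of_eq ?_)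
      rw [← h0, hμ.geo 0 (by simp) t htI, zero_sub, neg_sq]
    set f : X × X → ℝ≥0∞ := fun p => edist x p.2 ^ 2 with hf
    set g : X × X → ℝ≥0∞ := fun p => ENNReal.ofReal t⁻¹ * edist x p.1 ^ 2 +
      ENNReal.ofReal (1 - t)⁻¹ * edist p.1 p.2 ^ 2 with hg
    have hfI : ∫⁻ p, f p ∂π = I := by
      rw [hI, ← h2, lintegral_map (by fun_prop) measurable_snd]
    have hgI : ∫⁻ p, g p ∂π ≤ I + ENNReal.ofReal (1 - t)⁻¹ * ε := by
      rw [hg, lintegral_add_left (by fun_prop), lintegral_const_mul _ (by fun_prop),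
        lintegral_const_mul _ (by fun_prop)]
      have e1 : ∫⁻ p, edist x p.1 ^ 2 ∂π = ∫⁻ z, edist x z ^ 2 ∂(μ t) := by
        rw [← h1, lintegral_map (by fun_prop) measurable_fst]
      rw [e1]
      calc _ ≤ ENNReal.ofReal t⁻¹ * (ENNReal.ofReal (t ^ 2) * W) +
            ENNReal.ofReal (1 - t)⁻¹ * (ENNReal.ofReal ((1 - t) ^ 2) * W + ε) := by gcongr
        _ = (ENNReal.ofReal t + ENNReal.ofReal (1 - t)) * W + ENNReal.ofReal (1 - t)⁻¹ * ε := by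
          rw [mul_add, ← mul_assoc, ← mul_assoc, ← ENNReal.ofReal_mul (by positivity),
            ← ENNReal.ofReal_mul (by positivity), ← add_assoc, ← add_mul]
          congr 4 <;> field_simp
        _ ≤ I + ENNReal.ofReal (1 - t)⁻¹ * ε := by
          rw [← ENNReal.ofReal_add ht0.le ht1.le]
          simpa using add_le_add_left hWI _
    have hEπ : ∀ᵐ p ∂π, p.2 ∈ E := by
      rw [← h2] at hE
      exact ae_of_ae_map measurable_snd.aemeasurable hE
    have hpt : ∀ᵐ p ∂π, f p + (Prod.fst ⁻¹' Aᶜ).indicator (fun _ => ENNReal.ofReal (η ^ 2)) p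
        ≤ g p := by
      filter_upwards [hEπ] with p hp
      have hconv : g p = ENNReal.ofReal (dist x p.1 ^ 2 / t + dist p.1 p.2 ^ 2 / (1 - t)) := by
        rw [hg]
        simp only [edist_dist, ← ENNReal.ofReal_pow dist_nonneg]
        rw [← ENNReal.ofReal_mul (by positivity), ← ENNReal.ofReal_mul (by positivity),
          ← ENNReal.ofReal_add (by positivity) (by positivity)]
        congr 1
        ring
      have hconvf : f p = ENNReal.ofReal (dist x p.2 ^ 2) := by
        rw [hf]
        simp only [edist_dist, ← ENNReal.ofReal_pow dist_nonneg]
      rw [hconv, hconvf]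
      by_cases hpA : p.1 ∈ A
      · rw [indicator_of_notMem (by simpa using hpA), add_zero]
        apply ENNReal.ofReal_le_ofReal
        rw [div_add_div _ _ ht0.ne' ht1.ne', le_div_iff₀ (by positivity)]
        have htri := dist_triangle x p.1 p.2
        have hsq : dist x p.2 ^ 2 ≤ (dist x p.1 + dist p.1 p.2) ^ 2 := by gcongr
        nlinarith [sq_nonneg ((1 - t) * dist x p.1 - t * dist p.1 p.2), mul_pos ht0 ht1,
          mul_le_mul_of_nonneg_right hsq (mul_pos ht0 ht1).le]
      · rw [indicator_of_mem (by simpa using hpA), ← ENNReal.ofReal_add (by positivity)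
          (by positivity)]
        apply ENNReal.ofReal_le_ofReal
        by_contra! hlt
        exact hpA ⟨p.2, hp, lt_of_energy_gap_lt dist_nonneg dist_nonneg dist_nonneg ht hη hlt
          (dist_triangle _ _ _)⟩
    have hle := (lintegral_mono_ae hpt).trans hgI
    rw [lintegral_add_left (by fun_prop), hfI, lintegral_indicator_const (measurable_fst hAm),
      ← Measure.map_apply measurable_fst hAm, h1] at hle
    exact (ENNReal.add_le_add_iff_left hIfin.ne).1 hle
  have hzero : ENNReal.ofReal (η ^ 2) * μ t Aᶜ ≤ 0 := by
    refine ge_of_tendsto (x := 𝓝[>] (0 : ℝ≥0∞)) (f := fun ε => ENNReal.ofReal (1 - t)⁻¹ * ε) ?_ ?_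
    · have := ENNReal.Tendsto.const_mul (a := ENNReal.ofReal (1 - t)⁻¹)
        (tendsto_id (α := ℝ≥0∞) (x := 𝓝 0)) (Or.inr ENNReal.ofReal_ne_top)
      rw [mul_zero] at this
      exact this.mono_left nhdsWithin_le_nhds
    · filter_upwards [self_mem_nhdsWithin] with ε hε using hlim ε hε
  simpa [hη.ne', not_le.2 hη, sq_pos_of_pos hη] using hzero

end Transport

section Support

variable [MetricSpace X] [MeasurableSpace X]

theorem isClosed_mSupp (m : Measure X) : IsClosed (mSupp m) := by
  rw [← isOpen_compl_iff, Metric.isOpen_iff]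
  intro x hx
  simp only [mSupp, mem_compl_iff, mem_ofPred_eq, not_forall, not_lt, nonpos_iff_eq_zero] at hx
  obtain ⟨r, hr, h0⟩ := hx
  refine ⟨r / 2, half_pos hr, fun y hy hys => (hys (r / 2) (half_pos hr)).ne' ?_⟩
  refine measure_mono_null (ball_subset_ball' ?_) h0
  linarith [mem_ball.1 hy]

theorem measure_compl_mSupp [SecondCountableTopology X] (m : Measure X) : m (mSupp m)ᶜ = 0 := by
  refine measure_null_of_locally_null _ fun x hx => ?_
  simp only [mSupp, mem_compl_iff, mem_ofPred_eq, not_forall, not_lt, nonpos_iff_eq_zero] at hx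
  obtain ⟨r, hr, h0⟩ := hx
  exact ⟨ball x r, mem_nhdsWithin_of_mem_nhds (ball_mem_nhds x hr), h0⟩

theorem FiniteOnBounded.sigmaFinite [SecondCountableTopology X] {m : Measure X}
    (hm : FiniteOnBounded m) : SigmaFinite m := by
  have : IsLocallyFiniteMeasure m :=
    ⟨fun x => ⟨ball x 1, ball_mem_nhds x one_pos, hm _ isBounded_ball⟩⟩
  infer_instance

end Support

section Entropy

variable [MeasurableSpace X]

/-- A probability measure concentrated on `A` has dimensional entropy at most `m A`. -/
theorem UnE_one_le {μ m : Measure X} [IsProbabilityMeasure μ] [SigmaFinite m] {A : Set X}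
    (hA : MeasurableSet A) (hμA : μ Aᶜ = 0) : UnE 1 μ m ≤ m A := by
  by_cases htop : m A = ⊤
  · simp [htop]
  by_cases hent : μ ≪ m ∧
      Integrable (fun x => (μ.rnDeriv m x).toReal * Real.log (μ.rnDeriv m x).toReal) m
  swap
  · simp [UnE, Ent, hent]
  obtain ⟨hac, hint⟩ := hent
  have hμA1 : μ A = 1 := (prob_compl_eq_zero_iff hA).1 hμA
  have hmA : m A ≠ 0 := fun h => by simp [hac h] at hμA1
  set M := (m A).toReal with hM
  have hM0 : 0 < M := ENNReal.toReal_pos hmA htop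
  set ρ : X → ℝ := fun x => (μ.rnDeriv m x).toReal with hρ
  have hρint : Integrable ρ m := Measure.integrable_toReal_rnDeriv
  have hρA : ∫ x in A, ρ x ∂m = 1 := by
    rw [hρ, Measure.setIntegral_toReal_rnDeriv hac, measureReal_def, hμA1, ENNReal.toReal_one]
  have hzero : ∀ᵐ x ∂m, x ∉ A → ρ x = 0 := by
    have h0 : ∫⁻ x in Aᶜ, μ.rnDeriv m x ∂m = 0 := by
      rw [Measure.setLIntegral_rnDeriv hac, hμA]
    rw [lintegral_eq_zero_iff (Measure.measurable_rnDeriv μ m), Filter.EventuallyEq,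
      ae_restrict_iff' hA.compl] at h0
    filter_upwards [h0] with x hx hxA
    simp [hρ, hx hxA]
  have hpt : ∀ u : ℝ, 0 ≤ u → u * Real.log M⁻¹ + u - M⁻¹ ≤ u * Real.log u := by
    intro u hu
    rcases hu.eq_or_lt with rfl | hu
    · simp [hM0.le]
    have h := Real.log_le_sub_one_of_pos (x := M⁻¹ / u) (by positivity)
    rw [Real.log_div (by positivity) hu.ne'] at h
    have h2 := mul_le_mul_of_nonneg_left h hu.le
    have h3 : u * (M⁻¹ / u - 1) = M⁻¹ - u := by field_simp
    linarith
  have hconst : IntegrableOn (fun _ : X => M⁻¹) A m := integrableOn_const htop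
  have hlow : Real.log M⁻¹ ≤ ∫ x, ρ x * Real.log (ρ x) ∂m := by
    calc Real.log M⁻¹ = ∫ x in A, (ρ x * Real.log M⁻¹ + ρ x - M⁻¹) ∂m := by
          have h1 : Integrable (fun x => ρ x * Real.log M⁻¹) (m.restrict A) :=
            hρint.restrict.mul_const _
          have h2 : Integrable (fun x => ρ x * Real.log M⁻¹ + ρ x) (m.restrict A) :=
            h1.add hρint.restrict
          rw [integral_sub h2 hconst, integral_add h1 hρint.restrict, integral_mul_const, hρA,
            setIntegral_const, measureReal_def, ← hM, smul_eq_mul, mul_inv_cancel₀ hM0.ne']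
          ring
      _ ≤ ∫ x in A, ρ x * Real.log (ρ x) ∂m :=
          integral_mono (((hρint.restrict.mul_const _).add hρint.restrict).sub hconst)
            hint.restrict fun x => hpt _ ENNReal.toReal_nonneg
      _ = ∫ x, ρ x * Real.log (ρ x) ∂m := by
          refine setIntegral_eq_integral_of_ae_compl_eq_zero ?_
          filter_upwards [hzero] with x hx hxA
          simp [hx hxA]
  have hUn : UnE 1 μ m = ENNReal.ofReal (Real.exp (-∫ x, ρ x * Real.log (ρ x) ∂m)) := by
    rw [UnE, Ent, if_pos ⟨hac, hint⟩, inv_one, EReal.coe_one, one_mul, ← EReal.coe_neg,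
      EReal.exp_coe]
  rw [hUn, ← ENNReal.ofReal_toReal htop, ← hM]
  apply ENNReal.ofReal_le_ofReal
  rw [Real.log_inv] at hlow
  rw [← Real.le_log_iff_exp_le hM0]
  linarith

/-- The entropy of the normalized restriction of `m` to a set. -/
theorem Ent_uniform {m : Measure X} [SigmaFinite m] {E : Set X} (hE : MeasurableSet E)
    (h0 : m E ≠ 0) (htop : m E ≠ ⊤) :
    Ent ((m E)⁻¹ • m.restrict E) m = ((-Real.log (m E).toReal : ℝ) : EReal) := by
  have hfin : IsFiniteMeasure (m.restrict E) := ⟨by simpa using htop.lt_top⟩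
  have hac : (m E)⁻¹ • m.restrict E ≪ m :=
    Measure.restrict_le_self.absolutelyContinuous.smul_left _
  set M := (m E).toReal with hM
  have hM0 : 0 < M := ENNReal.toReal_pos h0 htop
  have hρ : (fun x => (((m E)⁻¹ • m.restrict E).rnDeriv m x).toReal *
      Real.log (((m E)⁻¹ • m.restrict E).rnDeriv m x).toReal) =ᵐ[m]
      E.indicator fun _ => M⁻¹ * Real.log M⁻¹ := by
    filter_upwards [Measure.rnDeriv_smul_left_of_ne_top (m.restrict E) m (ENNReal.inv_ne_top.2 h0),
      Measure.rnDeriv_restrict_self m hE] with x h1 h2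
    rw [h1, Pi.smul_apply, h2]
    by_cases hx : x ∈ E <;> simp [hx, hM]
  have hint : Integrable (E.indicator fun _ => M⁻¹ * Real.log M⁻¹) m :=
    (integrable_indicator_iff hE).2 (integrableOn_const htop)
  rw [Ent, if_pos ⟨hac, hint.congr hρ.symm⟩, integral_congr_ae hρ, integral_indicator hE,
    setIntegral_const, measureReal_def, ← hM, smul_eq_mul, mul_inv_cancel_left₀ hM0.ne',
    Real.log_inv]

theorem UnE_one_uniform {m : Measure X} [SigmaFinite m] {E : Set X} (hE : MeasurableSet E)
    (h0 : m E ≠ 0) (htop : m E ≠ ⊤) : UnE 1 ((m E)⁻¹ • m.restrict E) m = m E := by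
  rw [UnE, Ent_uniform hE h0 htop, inv_one, EReal.coe_one, one_mul, ← EReal.coe_neg, neg_neg,
    EReal.exp_coe, Real.exp_log (ENNReal.toReal_pos h0 htop), ENNReal.ofReal_toReal htop]

theorem le_exp_eintegral_log {μ : Measure X} [IsProbabilityMeasure μ] {f : X → ℝ≥0∞} {c : ℝ}
    (hc0 : 0 < c) (hc1 : c ≤ 1) (hf : ∀ᵐ y ∂μ, ENNReal.ofReal c ≤ f y) :
    ENNReal.ofReal c ≤ EReal.exp (eintegral μ fun y => ENNReal.log (f y)) := by
  have hlog : Real.log c ≤ 0 := Real.log_nonpos hc0.le hc1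
  have hneg : ∫⁻ y, epos (-(ENNReal.log (f y))) ∂μ ≤ ENNReal.ofReal (-Real.log c) := by
    calc ∫⁻ y, epos (-(ENNReal.log (f y))) ∂μ ≤ ∫⁻ _, ENNReal.ofReal (-Real.log c) ∂μ := by
          refine lintegral_mono_ae ?_
          filter_upwards [hf] with y hy
          have h1 : ((Real.log c : ℝ) : EReal) ≤ ENNReal.log (f y) := by
            rw [← ENNReal.log_ofReal_of_pos hc0]
            exact ENNReal.log_monotone hy
          generalize ENNReal.log (f y) = v at h1
          induction v with
          | bot => simp at h1
          | top => simp [epos]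
          | coe v =>
            rw [← EReal.coe_neg]
            simp only [epos, EReal.coe_ne_top, if_false, EReal.toReal_coe]
            exact ENNReal.ofReal_le_ofReal (neg_le_neg (EReal.coe_le_coe_iff.1 h1))
      _ = ENNReal.ofReal (-Real.log c) := by simp
  have h2 : ((∫⁻ y, epos (-(ENNReal.log (f y))) ∂μ : ℝ≥0∞) : EReal) ≤
      ((-Real.log c : ℝ) : EReal) := by
    refine (EReal.coe_ennreal_le_coe_ennreal_iff.2 hneg).trans ?_
    rw [EReal.coe_ennreal_ofReal, max_eq_left (by linarith)]
  have h3 : ((Real.log c : ℝ) : EReal) ≤ eintegral μ fun y => ENNReal.log (f y) := by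
    calc ((Real.log c : ℝ) : EReal) = 0 - ((-Real.log c : ℝ) : EReal) := by
          rw [zero_sub, ← EReal.coe_neg, neg_neg]
      _ ≤ _ := EReal.sub_le_sub (EReal.coe_ennreal_nonneg _) h2
  calc ENNReal.ofReal c = EReal.exp (Real.log c : ℝ) := by rw [EReal.exp_coe, Real.exp_log hc0]
    _ ≤ _ := EReal.exp_monotone h3

end Entropy

section Distortion

variable {s : ℝ → ℝ} {N : ℝ}

theorem DistortionData.exists_bounds_near_zero (h : DistortionData s N) :
    ∃ c > 0, ∃ δ > 0, ∀ θ ∈ Ioc (0 : ℝ) δ, c * θ ^ N ≤ s θ ∧ s θ ≤ 3 * c * θ ^ N := by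
  obtain ⟨c, hc, ho⟩ := h.asymp
  have hb := ho.bound (half_pos hc)
  obtain ⟨δ, hδ, hsub⟩ := mem_nhdsGT_iff_exists_Ioc_subset.1 hb
  refine ⟨c / 2, half_pos hc, δ, hδ, fun θ hθ => ?_⟩
  have h1 : ‖s θ - c * θ ^ N‖ ≤ c / 2 * ‖θ ^ N‖ := hsub hθ
  have h0 : 0 ≤ θ ^ N := Real.rpow_nonneg hθ.1.le N
  rw [Real.norm_eq_abs, Real.norm_eq_abs, abs_of_nonneg h0] at h1
  obtain ⟨h2, h3⟩ := abs_le.1 h1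
  constructor <;> linarith

theorem DistortionData.Dcal_pos (h : DistortionData s N) : 0 < Dcal s := by
  obtain ⟨c, hc, δ, hδ, hb⟩ := h.exists_bounds_near_zero
  refine (ENNReal.ofReal_pos.2 hδ).trans_le (le_sInf ?_)
  rintro _ ⟨θ, ⟨hθ, hs⟩, rfl⟩
  by_contra! hlt
  have := (hb θ ⟨hθ, ((ENNReal.ofReal_lt_ofReal_iff hδ).1 hlt).le⟩).1
  have := mul_pos hc (Real.rpow_pos_of_pos hθ N)
  linarith

theorem DistortionData.pos_of_lt_Dcal (h : DistortionData s N) {θ : ℝ} (hθ : 0 < θ)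
    (hlt : ENNReal.ofReal θ < Dcal s) : 0 < s θ := by
  obtain ⟨c, hc, δ, hδ, hb⟩ := h.exists_bounds_near_zero
  have hpos : ∀ θ ∈ Ioc (0 : ℝ) δ, 0 < s θ := fun θ hθ =>
    (mul_pos hc (Real.rpow_pos_of_pos hθ.1 N)).trans_le (hb θ hθ).1
  by_contra! hs
  have hδθ : δ < θ := by
    by_contra! hle
    exact (hpos θ ⟨hθ, hle⟩).not_ge hs
  obtain ⟨ξ, hξ, hξ0⟩ := intermediate_value_Icc' hδθ.le
    (h.cont.mono fun y hy => hδ.le.trans hy.1) ⟨hs, (hpos δ ⟨hδ, le_rfl⟩).le⟩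
  have : Dcal s ≤ ENNReal.ofReal ξ := sInf_le ⟨ξ, ⟨hδ.trans_le hξ.1, hξ0⟩, rfl⟩
  exact (this.trans (ENNReal.ofReal_le_ofReal hξ.2)).not_gt hlt

/-- The ratios `s (t θ) / s θ` are bounded below by a positive constant for `0 < θ < 𝒟` in a
bounded range. -/
theorem DistortionData.exists_le_ratio (h : DistortionData s N) {t : ℝ} (ht : t ∈ Ioo (0 : ℝ) 1)
    (D : ℝ) : ∃ c > 0, ∀ θ : ℝ, 0 < θ → θ ≤ D → ENNReal.ofReal θ < Dcal s →
      c ≤ s (t * θ) / s θ := by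
  obtain ⟨k, hk, δ, hδ, hb⟩ := h.exists_bounds_near_zero
  have hnear : ∀ θ ∈ Ioc (0 : ℝ) δ, t ^ N / 3 ≤ s (t * θ) / s θ := by
    intro θ hθ
    have hθN := Real.rpow_pos_of_pos hθ.1 N
    have hs := (mul_pos hk hθN).trans_le (hb θ hθ).1
    have h1 := (hb (t * θ) ⟨mul_pos ht.1 hθ.1,
      (mul_le_of_le_one_left hθ.1.le ht.2.le).trans hθ.2⟩).1
    have h2 := (hb θ hθ).2
    rw [Real.mul_rpow ht.1.le hθ.1.le] at h1
    rw [le_div_iff₀ hs]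
    have htN := Real.rpow_nonneg ht.1.le N
    nlinarith [mul_le_mul_of_nonneg_left h2 htN]
  have htN : 0 < t ^ N / 3 := div_pos (Real.rpow_pos_of_pos ht.1 N) (by norm_num)
  set M := min (ENNReal.ofReal D) (Dcal s) with hM
  have hMtop : M ≠ ⊤ := ((min_le_left _ _).trans_lt ENNReal.ofReal_lt_top).ne
  set D' := M.toReal with hD'
  have hfar : ∃ c > 0, ∀ θ : ℝ, δ ≤ θ → θ ≤ D' → 0 < s θ → c ≤ s (t * θ) / s θ := by
    by_cases hle : δ ≤ D'
    swap
    · exact ⟨1, one_pos, fun θ h1 h2 => absurd (h1.trans h2) hle⟩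
    have hD'0 : 0 < D' := hδ.trans_le hle
    obtain ⟨ξ, hξ, hmin⟩ := (isCompact_Icc (a := t * δ) (b := t * D')).exists_isMinOn
      (nonempty_Icc.2 (mul_le_mul_of_nonneg_left hle ht.1.le))
      (h.cont.mono fun y hy => (mul_pos ht.1 hδ).le.trans hy.1)
    obtain ⟨ζ, hζ, hmax⟩ := (isCompact_Icc (a := δ) (b := D')).exists_isMaxOn
      (nonempty_Icc.2 hle) (h.cont.mono fun y hy => hδ.le.trans hy.1)
    have hsξ : 0 < s ξ := by
      refine h.pos_of_lt_Dcal ((mul_pos ht.1 hδ).trans_le hξ.1) ?_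
      calc ENNReal.ofReal ξ < ENNReal.ofReal D' :=
            (ENNReal.ofReal_lt_ofReal_iff hD'0).2
              (hξ.2.trans_lt (mul_lt_of_lt_one_left hD'0 ht.2))
        _ = M := ENNReal.ofReal_toReal hMtop
        _ ≤ Dcal s := min_le_right _ _
    refine ⟨s ξ / (|s ζ| + 1), by positivity, fun θ h1 h2 h3 => ?_⟩
    have hm : s ξ ≤ s (t * θ) :=
      hmin ⟨mul_le_mul_of_nonneg_left h1 ht.1.le, mul_le_mul_of_nonneg_left h2 ht.1.le⟩
    have hx : s θ ≤ s ζ := hmax ⟨h1, h2⟩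
    exact div_le_div₀ (hsξ.le.trans hm) hm h3 (by linarith [le_abs_self (s ζ)])
  obtain ⟨c, hc, hcfar⟩ := hfar
  refine ⟨min (t ^ N / 3) c, lt_min htN hc, fun θ h0 hθD hlt => ?_⟩
  rcases le_or_gt θ δ with hle | hgt
  · exact (min_le_left _ _).trans (hnear θ ⟨h0, hle⟩)
  · refine (min_le_right _ _).trans (hcfar θ hgt.le ?_ (h.pos_of_lt_Dcal h0 hlt))
    rw [hD', ← ENNReal.ofReal_le_iff_le_toReal hMtop]
    exact le_min (ENNReal.ofReal_le_ofReal hθD) hlt.le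

/-- On a bounded range of gauges, `β_t` is bounded below by a positive constant. -/
theorem DistortionData.exists_le_beta (h : DistortionData s N) {t : ℝ} (ht : t ∈ Ioo (0 : ℝ) 1)
    {D : ℝ≥0∞} (hD : D < ⊤) :
    ∃ c : ℝ, 0 < c ∧ c ≤ 1 ∧ ∀ θ ≤ D, ENNReal.ofReal c ≤ beta s N t θ := by
  obtain ⟨c, hc, hratio⟩ := h.exists_le_ratio ht D.toReal
  have htN : 0 < t ^ N := Real.rpow_pos_of_pos ht.1 N
  have hratio' : ∀ φ : ℝ≥0∞, φ ≠ 0 → φ ≤ D → φ < Dcal s →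
      ENNReal.ofReal c ≤ ENNReal.ofReal (s (t * φ.toReal) / s φ.toReal) := by
    intro φ h0 hφD hφ
    have htop : φ ≠ ⊤ := (hφD.trans_lt hD).ne
    refine ENNReal.ofReal_le_ofReal (hratio _ (ENNReal.toReal_pos h0 htop)
      (ENNReal.toReal_mono hD.ne hφD) ?_)
    rwa [ENNReal.ofReal_toReal htop]
  refine ⟨min 1 (min (t ^ N) c), by positivity, min_le_left _ _, fun θ hθ => ?_⟩
  have hle : ENNReal.ofReal (min 1 (min (t ^ N) c)) ≤ ENNReal.ofReal c :=
    ENNReal.ofReal_le_ofReal ((min_le_right _ _).trans (min_le_right _ _))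
  unfold beta
  split_ifs with h0 hlt
  · exact ENNReal.ofReal_le_ofReal ((min_le_right _ _).trans (min_le_left _ _))
  · exact hle.trans (hratio' θ h0 hθ hlt)
  · refine hle.trans (le_liminf_of_le (by isBoundedDefault) ?_)
    filter_upwards [Ioo_mem_nhdsLT h.Dcal_pos] with φ hφ
    exact hratio' φ hφ.1.ne' (hφ.2.le.trans ((not_lt.1 hlt).trans hθ)) hφ.2

end Distortion

section Contraction

variable [MetricSpace X] [MeasurableSpace X] {m : Measure X} {G : X → X → ℝ≥0∞}

/-- Uniform lower bound on the distortion coefficients over a bounded subset of the support. -/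
theorem exists_ae_le_beta {s : ℝ → ℝ} {N : ℝ} (hsN : DistortionData s N)
    (hyp : (∀ S : Set X, S ⊆ mSupp m → Bornology.IsBounded S → diamG m G S < ⊤) ∨
      (∀ t ∈ Set.Icc (0:ℝ) 1, Monotone (beta s N t)))
    {S : Set X} (hS : S ⊆ mSupp m) (hSb : Bornology.IsBounded S) {t : ℝ}
    (ht : t ∈ Ioo (0 : ℝ) 1) :
    ∃ c : ℝ, 0 < c ∧ c ≤ 1 ∧ ∀ x ∈ S, ∀ᵐ y ∂(m.restrict (S \ {x})),
      ENNReal.ofReal c ≤ beta s N t (G x y) := by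
  rcases hyp with hyp | hyp
  · obtain ⟨c, hc0, hc1, hc⟩ := hsN.exists_le_beta ht (hyp S hS hSb)
    refine ⟨c, hc0, hc1, fun x hx => ?_⟩
    filter_upwards [ENNReal.ae_le_essSup (μ := m.restrict (S \ {x})) fun y => G x y] with y hy
    exact hc _ (hy.trans (le_iSup₂ (f := fun x (_ : x ∈ S) =>
      essSup (fun y => G x y) (m.restrict (S \ {x}))) x hx))
  · refine ⟨t ^ N, Real.rpow_pos_of_pos ht.1 N, Real.rpow_le_one ht.1.le ht.2.le
      (zero_le_one.trans hsN.one_le), fun x _ => ae_of_all _ fun y => ?_⟩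
    have h0 : beta s N t 0 = ENNReal.ofReal (t ^ N) := by simp [beta]
    rw [← h0]
    exact hyp t ⟨ht.1.le, ht.2.le⟩ bot_le

variable [BorelSpace X]

/-- The normalized restriction of `m` to a bounded set of positive measure in its support has
bounded support and finite entropy. -/
theorem uniform_mem_PbsStar [SigmaFinite m] {E : Set X} (hE : MeasurableSet E)
    (hb : Bornology.IsBounded E) (h0 : m E ≠ 0) (htop : m E ≠ ⊤) :
    (m E)⁻¹ • m.restrict E ∈ PbsStar m := by
  have hpos : ∀ x ∈ mSupp ((m E)⁻¹ • m.restrict E), ∀ r : ℝ, 0 < r → m (ball x r ∩ E) ≠ 0 := by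
    intro x hx r hr h
    have := hx r hr
    simp [Measure.restrict_apply measurableSet_ball, h] at this
  refine ⟨⟨⟨?_⟩, ?_, ?_⟩, ?_⟩
  · simp [ENNReal.inv_mul_cancel h0 htop]
  · refine hb.closure.subset fun x hx => Metric.mem_closure_iff.2 fun r hr => ?_
    obtain ⟨y, hy, hyE⟩ := nonempty_of_measure_ne_zero (hpos x hx r hr)
    exact ⟨y, hyE, mem_ball'.1 hy⟩
  · intro x hx r hr
    exact (pos_iff_ne_zero.2 (hpos x hx r hr)).trans_le (measure_mono inter_subset_left)
  · rw [Ent_uniform hE h0 htop]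
    exact EReal.coe_ne_top _

/-- The measure contraction property yields a lower bound on the measure of approximate
intermediate points, uniform over base points and targets in a bounded set. -/
theorem MCP.exists_mul_measure_le [SecondCountableTopology X] (hm : FiniteOnBounded m) {s : ℝ → ℝ} {N : ℝ}
    (hsN : DistortionData s N) (hMCP : MCP m G (beta s N))
    (hyp : (∀ S : Set X, S ⊆ mSupp m → Bornology.IsBounded S → diamG m G S < ⊤) ∨
      (∀ t ∈ Set.Icc (0:ℝ) 1, Monotone (beta s N t)))
    {S : Set X} (hS : S ⊆ mSupp m) (hSb : Bornology.IsBounded S) {t : ℝ}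
    (ht : t ∈ Ioo (0 : ℝ) 1) :
    ∃ c : ℝ≥0∞, c ≠ 0 ∧ c ≤ 1 ∧ ∀ x ∈ S, ∀ E ⊆ S, MeasurableSet E → m E ≠ 0 →
      (∃ r > 0, Disjoint (ball x r) E) → ∀ η > 0,
        c * m E ≤ m (approxIntermediate x E t η) := by
  obtain ⟨c, hc0, hc1, hc⟩ := exists_ae_le_beta hsN hyp hS hSb ht
  refine ⟨ENNReal.ofReal c, by simpa using hc0, by simpa using hc1, fun x hx E hES hE hE0 hdisj η hη => ?_⟩
  have := hm.sigmaFinite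
  have hEb := hSb.subset hES
  have htop : m E ≠ ⊤ := (hm E hEb).ne
  obtain ⟨r, hr, hdisj⟩ := hdisj
  have hxE : x ∉ E := fun h => disjoint_left.1 hdisj (mem_ball_self hr) h
  have hmem := uniform_mem_PbsStar hE hEb hE0 htop
  have hprob := hmem.1.1
  have hxs : x ∉ mSupp ((m E)⁻¹ • m.restrict E) := fun h => by
    have := h r hr
    simp [Measure.restrict_apply measurableSet_ball, hdisj.inter_eq] at this
  obtain ⟨μ, hμ, hμ0, hμ1, hineq⟩ := hMCP x (hS hx) _ hmem hxs
  have hae : ∀ {p : X → Prop}, (∀ᵐ y ∂(m.restrict E), p y) →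
      ∀ᵐ y ∂((m E)⁻¹ • m.restrict E), p y := fun h => Measure.ae_smul_measure h _
  have hconc := hμ.measure_compl_approxIntermediate hμ0 (E := E) (t := t) (η := η)
    (hμ1 ▸ hae (ae_restrict_mem hE)) hEb ht hη
  have := hμ.prob t ⟨ht.1.le, ht.2.le⟩
  have hbeta : ∀ᵐ y ∂((m E)⁻¹ • m.restrict E), ENNReal.ofReal c ≤ beta s N t (G x y) :=
    hae (ae_mono (Measure.restrict_mono (subset_sdiff_singleton hES hxE) le_rfl) (hc x hx))
  have h1 := hineq t ht 1 le_rfl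
  rw [inv_one, EReal.coe_one, one_mul, UnE_one_uniform hE hE0 htop] at h1
  calc ENNReal.ofReal c * m E ≤ _ := by gcongr; exact le_exp_eintegral_log hc0 hc1 hbeta
    _ ≤ _ := h1
    _ ≤ _ := UnE_one_le (isOpen_approxIntermediate x E t η).measurableSet hconc

end Contraction

section Compactness

variable [MetricSpace X] [MeasurableSpace X] [BorelSpace X] [SecondCountableTopology X]
  {m : Measure X} {G : X → X → ℝ≥0∞} {s : ℝ → ℝ} {N : ℝ}

/-- Balls of fixed radius centred in a bounded part of the support have measure bounded below. -/
theorem MCP.exists_le_measure_ball (hm : FiniteOnBounded m) (hsN : DistortionData s N)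
    (hMCP : MCP m G (beta s N))
    (hyp : (∀ S : Set X, S ⊆ mSupp m → Bornology.IsBounded S → diamG m G S < ⊤) ∨
      (∀ t ∈ Set.Icc (0:ℝ) 1, Monotone (beta s N t)))
    {x₀ : X} (hx₀ : x₀ ∈ mSupp m) {R ε : ℝ} (hR : 0 < R) (hε : 0 < ε) :
    ∃ κ > 0, ∀ x ∈ mSupp m ∩ ball x₀ R, κ ≤ m (ball x ε) := by
  set S := mSupp m ∩ ball x₀ R with hS
  have hSm : MeasurableSet S := (isClosed_mSupp m).measurableSet.inter measurableSet_ball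
  have hSb : Bornology.IsBounded S := isBounded_ball.subset inter_subset_right
  have hS0 : m S ≠ 0 := by
    rw [hS, inter_comm, measure_inter_conull (measure_compl_mSupp m)]
    exact (hx₀ R hR).ne'
  set t := ε / (ε + 4 * R) with ht
  have ht01 : t ∈ Ioo (0 : ℝ) 1 := ⟨by positivity, by rw [ht, div_lt_one (by positivity)]; linarith⟩
  have htR : t * (2 * R) ≤ ε / 2 := by
    rw [ht, div_mul_eq_mul_div, div_le_iff₀ (by positivity)]
    nlinarith
  obtain ⟨c, hc0, hc1, hc⟩ := hMCP.exists_mul_measure_le hm hsN hyp inter_subset_left hSb ht01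
  refine ⟨c * m S / 2, ENNReal.half_pos (mul_ne_zero hc0 hS0), fun x hx => ?_⟩
  have hsub : approxIntermediate x (S \ ball x (ε / 2)) t (ε / 4) ⊆ ball x ε := by
    rintro z ⟨y, hy, hz, -⟩
    have h1 : dist x y < 2 * R := by
      linarith [dist_triangle_right x y x₀, mem_ball.1 hx.2, mem_ball.1 hy.1.2]
    rw [mem_ball']
    nlinarith [mul_le_mul_of_nonneg_left h1.le ht01.1.le]
  have hE : c * m (S \ ball x (ε / 2)) ≤ m (ball x ε) := by
    by_cases h0 : m (S \ ball x (ε / 2)) = 0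
    · simp [h0]
    · exact (hc x hx _ sdiff_subset (hSm.diff measurableSet_ball) h0
        ⟨ε / 2, half_pos hε, disjoint_sdiff_right⟩ (ε / 4) (by positivity)).trans
        (measure_mono hsub)
  have hball : c * m (ball x (ε / 2)) ≤ m (ball x ε) :=
    (mul_le_of_le_one_left' hc1).trans (measure_mono (ball_subset_ball (by linarith)))
  refine ENNReal.div_le_of_le_mul ?_
  calc c * m S ≤ c * (m (S \ ball x (ε / 2)) + m (ball x (ε / 2))) := by
        gcongr
        refine (measure_mono ?_).trans (measure_union_le _ _)
        exact fun y hy => (em (y ∈ ball x (ε / 2))).elim Or.inr fun h => Or.inl ⟨hy, h⟩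
    _ ≤ m (ball x ε) * 2 := by
        rw [mul_add, mul_two]
        exact add_le_add hE hball

theorem MCP.isCompact_of_isClosed_isBounded [CompleteSpace X] (hm : FiniteOnBounded m)
    (hsN : DistortionData s N) (hMCP : MCP m G (beta s N))
    (hyp : (∀ S : Set X, S ⊆ mSupp m → Bornology.IsBounded S → diamG m G S < ⊤) ∨
      (∀ t ∈ Set.Icc (0:ℝ) 1, Monotone (beta s N t)))
    {K : Set X} (hK : K ⊆ mSupp m) (hKc : IsClosed K) (hKb : Bornology.IsBounded K) :
    IsCompact K := by
  rcases K.eq_empty_or_nonempty with rfl | ⟨x₀, hx₀⟩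
  · exact isCompact_empty
  refine TotallyBounded.isCompact_of_isClosed (Metric.totallyBounded_iff.2 fun ε hε => ?_) hKc
  by_contra! hcov
  obtain ⟨R, hR, hKR⟩ := hKb.subset_ball_lt 0 x₀
  obtain ⟨κ, hκ, hball⟩ := hMCP.exists_le_measure_ball hm hsN hyp (hK hx₀) hR (half_pos hε)
  obtain ⟨f, hfK, hf⟩ := exists_seq_of_forall_finset_exists (fun x => x ∈ K)
    (fun x y => ε ≤ dist x y) fun F _ => by
      obtain ⟨y, hyK, hy⟩ := not_subset.1 (hcov F F.finite_toSet)
      refine ⟨y, hyK, fun x hx => ?_⟩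
      by_contra! hlt
      exact hy (mem_biUnion (Finset.mem_coe.2 hx) (mem_ball'.2 hlt))
  have hsep : ∀ i j, i ≠ j → ε ≤ dist (f i) (f j) := fun i j hij =>
    hij.lt_or_gt.elim (hf i j) fun h => dist_comm (f i) (f j) ▸ hf j i h
  have hfin := Measure.finite_const_le_meas_of_disjoint_iUnion m hκ
    (As := fun i : ℕ => ball (f i) (ε / 2)) (fun _ => measurableSet_ball)
    (fun i j hij => ball_disjoint_ball (by linarith [hsep i j hij]))
    (hm _ (isBounded_ball.subset (iUnion_subset fun i =>
      ball_subset_ball' (y := x₀) (ε₂ := ε / 2 + R) (by linarith [mem_ball.1 (hKR (hfK i))])))).ne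
  refine infinite_univ (α := ℕ) (hfin.subset fun i _ => ?_)
  exact hball (f i) ⟨hK (hfK i), hKR (hfK i)⟩

/-- Any two points of the support have exact intermediate points in the support. -/
theorem MCP.exists_intermediate [CompleteSpace X] (hm : FiniteOnBounded m)
    (hsN : DistortionData s N) (hMCP : MCP m G (beta s N))
    (hyp : (∀ S : Set X, S ⊆ mSupp m → Bornology.IsBounded S → diamG m G S < ⊤) ∨
      (∀ t ∈ Set.Icc (0:ℝ) 1, Monotone (beta s N t)))
    {x y : X} (hx : x ∈ mSupp m) (hy : y ∈ mSupp m) {t : ℝ} (ht : t ∈ Icc (0 : ℝ) 1) :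
    ∃ z ∈ mSupp m, dist x z ≤ t * dist x y ∧ dist z y ≤ (1 - t) * dist x y := by
  rcases ht.1.eq_or_lt with rfl | ht0
  · exact ⟨x, hx, by simp⟩
  rcases ht.2.eq_or_lt with rfl | ht1
  · exact ⟨y, hy, by simp⟩
  by_cases hxy : x = y
  · exact ⟨x, hx, by simp [hxy]⟩
  have hd : 0 < dist x y := dist_pos.2 hxy
  have happrox : ∀ ε ∈ Ioo (0 : ℝ) (dist x y / 2), ∃ z ∈ mSupp m,
      dist x z < t * dist x y + 4 * ε ∧ dist z y < (1 - t) * dist x y + 4 * ε := by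
    rintro ε ⟨hε, hεd⟩
    have hbb : Bornology.IsBounded (mSupp m ∩ ball y ε) :=
      isBounded_ball.subset inter_subset_right
    obtain ⟨c, hc0, -, hc⟩ := hMCP.exists_mul_measure_le hm hsN hyp
      (S := insert x (mSupp m ∩ ball y ε)) (insert_subset hx inter_subset_left)
      (hbb.insert x) ⟨ht0, ht1⟩
    have hE0 : m (mSupp m ∩ ball y ε) ≠ 0 := by
      rw [inter_comm, measure_inter_conull (measure_compl_mSupp m)]
      exact (hy ε hε).ne'
    have hle := hc x (mem_insert _ _) _ (subset_insert _ _)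
      ((isClosed_mSupp m).measurableSet.inter measurableSet_ball) hE0
      ⟨ε, hε, (ball_disjoint_ball (by linarith)).mono_right inter_subset_right⟩ (ε / 2)
      (half_pos hε)
    have hpos : m (approxIntermediate x (mSupp m ∩ ball y ε) t (ε / 2) ∩ mSupp m) ≠ 0 := by
      rw [measure_inter_conull (measure_compl_mSupp m)]
      exact ((pos_iff_ne_zero.2 (mul_ne_zero hc0 hE0)).trans_le hle).ne'
    obtain ⟨z, ⟨y', hy', h1, h2⟩, hz⟩ := nonempty_of_measure_ne_zero hpos
    have hyy := mem_ball.1 hy'.2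
    have hxy' : dist x y' ≤ dist x y + ε := by linarith [dist_triangle_right x y' y]
    refine ⟨z, hz, ?_, ?_⟩
    · nlinarith
    · nlinarith [dist_triangle z y' y]
  set C : ℝ → Set X := fun ε => mSupp m ∩
    (closedBall x (t * dist x y + 4 * ε) ∩ closedBall y ((1 - t) * dist x y + 4 * ε)) with hC
  have hcomp : ∀ ε, IsCompact (C ε) := fun ε =>
    hMCP.isCompact_of_isClosed_isBounded hm hsN hyp inter_subset_left
      ((isClosed_mSupp m).inter (isClosed_closedBall.inter isClosed_closedBall))
      (isBounded_closedBall.subset (inter_subset_right.trans inter_subset_left))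
  have hmono : Monotone C := fun a b hab => inter_subset_inter_right _
    (inter_subset_inter (closedBall_subset_closedBall (by linarith))
      (closedBall_subset_closedBall (by linarith)))
  have : Nonempty (Ioo (0 : ℝ) (dist x y / 2)) :=
    ⟨⟨dist x y / 4, by constructor <;> linarith⟩⟩
  have hne := IsCompact.nonempty_iInter_of_directed_nonempty_isCompact_isClosed
    (fun ε : Ioo (0 : ℝ) (dist x y / 2) => C ε)
    (directed_of_isDirected_ge fun a b hab => hmono hab)
    (fun ε => by
      obtain ⟨z, hz, h1, h2⟩ := happrox ε ε.2
      exact ⟨z, hz, mem_closedBall'.2 h1.le, mem_closedBall.2 h2.le⟩)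
    (fun ε => hcomp ε) (fun ε => (hcomp ε).isClosed)
  obtain ⟨z, hz⟩ := hne
  rw [mem_iInter] at hz
  have hmin : ∀ δ > 0, ∃ ε : Ioo (0 : ℝ) (dist x y / 2), 4 * (ε : ℝ) ≤ δ := fun δ hδ =>
    ⟨⟨min (δ / 4) (dist x y / 4), lt_min (by linarith) (by linarith),
      (min_le_right _ _).trans_lt (by linarith)⟩, by linarith [min_le_left (δ / 4) (dist x y / 4)]⟩
  refine ⟨z, (hz ⟨dist x y / 4, by constructor <;> linarith⟩).1,
    le_of_forall_pos_le_add fun δ hδ => ?_, le_of_forall_pos_le_add fun δ hδ => ?_⟩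
  · obtain ⟨ε, hε⟩ := hmin δ hδ
    linarith [mem_closedBall'.1 (hz ε).2.1]
  · obtain ⟨ε, hε⟩ := hmin δ hδ
    linarith [mem_closedBall.1 (hz ε).2.2]

end Compactness
section Geodesics

variable [MetricSpace X]

/-- In a set with intermediate points, finitely many points of a geodesic can be prescribed. -/
theorem exists_finite_geodesic {S : Set X}
    (hS : ∀ x ∈ S, ∀ y ∈ S, ∀ t ∈ Icc (0 : ℝ) 1,
      ∃ z ∈ S, dist x z ≤ t * dist x y ∧ dist z y ≤ (1 - t) * dist x y)
    {x : X} (hx : x ∈ S) {L : ℝ} (hL : 0 ≤ L) (F : Finset unitInterval) :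
    ∀ b : ℝ, 0 ≤ b → (∀ a ∈ F, (a : ℝ) ≤ b) → ∀ y ∈ S, dist x y ≤ L * b →
      ∃ f : unitInterval → X, (∀ a, f a ∈ S ∧ dist x (f a) ≤ L * b) ∧
        (∀ a ∈ F, dist x (f a) ≤ L * a ∧ dist (f a) y ≤ L * (b - a)) ∧
        ∀ a ∈ F, ∀ a' ∈ F, a ≤ a' → dist (f a) (f a') ≤ L * (a' - a) := by
  induction F using Finset.induction_on_max with
  | empty =>
    intro b hb _ y _ _
    exact ⟨fun _ => x, fun _ => ⟨hx, by simpa using mul_nonneg hL hb⟩, by simp, by simp⟩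
  | insert a F hF ih =>
    intro b hb hFb y hy hxy
    have hab : (a : ℝ) ≤ b := hFb a (Finset.mem_insert_self _ _)
    have ha : (0 : ℝ) ≤ a := a.2.1
    obtain ⟨p, hp, hxp, hpy⟩ : ∃ p ∈ S, dist x p ≤ L * a ∧ dist p y ≤ L * (b - a) := by
      rcases hb.eq_or_lt with rfl | hb'
      · have h0 : (a : ℝ) = 0 := le_antisymm hab ha
        exact ⟨x, hx, by simp [h0], by simpa [h0] using hxy⟩
      · obtain ⟨p, hp, h1, h2⟩ := hS x hx y hy (a / b)
          ⟨div_nonneg ha hb, div_le_one_of_le₀ hab hb⟩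
        refine ⟨p, hp, h1.trans ?_, h2.trans ?_⟩
        · calc (a : ℝ) / b * dist x y ≤ a / b * (L * b) := by gcongr
            _ = L * a := by field_simp
        · have : 0 ≤ 1 - (a : ℝ) / b := sub_nonneg.2 (div_le_one_of_le₀ hab hb)
          calc (1 - (a : ℝ) / b) * dist x y ≤ (1 - a / b) * (L * b) := by gcongr
            _ = L * (b - a) := by field_simp
    obtain ⟨f, hf, hfx, hff⟩ := ih a ha (fun c hc => (hF c hc).le) p hp hxp
    have hLab : L * a ≤ L * b := by gcongr
    refine ⟨fun c => if c < a then f c else p, fun c => ?_, fun c hc => ?_,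
      fun c hc c' hc' hcc => ?_⟩
    · beta_reduce
      split_ifs
      · exact ⟨(hf c).1, (hf c).2.trans hLab⟩
      · exact ⟨hp, hxp.trans hLab⟩
    · rcases Finset.mem_insert.1 hc with rfl | hc
      · simpa using ⟨hxp, hpy⟩
      · simp only [hF c hc, if_true]
        refine ⟨(hfx c hc).1, ?_⟩
        linarith [dist_triangle (f c) p y, (hfx c hc).2]
    · rcases Finset.mem_insert.1 hc with rfl | hcF
      · have : c' = c := (Finset.mem_insert.1 hc').resolve_right fun h => hcc.not_gt (hF c' h)
        simp [this]
      · rcases Finset.mem_insert.1 hc' with rfl | hcF'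
        · simpa [hF c hcF] using (hfx c hcF).2
        · simpa [hF c hcF, hF c' hcF'] using hff c hcF c' hcF' hcc

/-- A set with compact bounded parts and intermediate points is geodesic. -/
theorem exists_geoSpace_of_exists_intermediate {S : Set X}
    (hScomp : ∀ x r, IsCompact (S ∩ closedBall x r))
    (hS : ∀ x ∈ S, ∀ y ∈ S, ∀ t ∈ Icc (0 : ℝ) 1,
      ∃ z ∈ S, dist x z ≤ t * dist x y ∧ dist z y ≤ (1 - t) * dist x y)
    {x y : X} (hx : x ∈ S) (hy : y ∈ S) :
    ∃ γ : GeoSpace X, γ.1 0 = x ∧ γ.1 1 = y ∧ ∀ t, γ.1 t ∈ S := by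
  set L := dist x y with hLdef
  have hL : 0 ≤ L := dist_nonneg
  set T : unitInterval × unitInterval → Set (unitInterval → X) := fun q =>
    {f | dist (f q.1) (f q.2) ≤ L * |(q.1 : ℝ) - q.2|} ∩
      ({f | dist x (f q.1) ≤ L * q.1} ∩ {f | dist (f q.1) y ≤ L * (1 - q.1)}) with hT
  have hTc : ∀ q, IsClosed (T q) := fun q =>
    (isClosed_le (by fun_prop) continuous_const).inter
      ((isClosed_le (by fun_prop) continuous_const).inter
        (isClosed_le (by fun_prop) continuous_const))
  have hcomp : IsCompact (univ.pi fun _ : unitInterval => S ∩ closedBall x L) :=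
    isCompact_univ_pi fun _ => hScomp x L
  obtain ⟨f, hfS, hfT⟩ := hcomp.inter_iInter_nonempty T hTc fun u => by
    obtain ⟨f, h1, h2, h3⟩ := exists_finite_geodesic hS hx hL
      (u.image Prod.fst ∪ u.image Prod.snd) 1 zero_le_one (fun a _ => a.2.2) y hy (by simp [hLdef])
    refine ⟨f, fun a _ => ⟨(h1 a).1, mem_closedBall'.2 (by simpa using (h1 a).2)⟩,
      mem_iInter₂.2 fun q hq => ?_⟩
    have hq1 := Finset.mem_union_left (u.image Prod.snd) (Finset.mem_image_of_mem Prod.fst hq)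
    have hq2 := Finset.mem_union_right (u.image Prod.fst) (Finset.mem_image_of_mem Prod.snd hq)
    refine ⟨?_, (h2 _ hq1).1, (h2 _ hq1).2⟩
    change dist (f q.1) (f q.2) ≤ L * |(q.1 : ℝ) - q.2|
    rcases le_total q.1 q.2 with h | h
    · rw [abs_sub_comm]
      exact (h3 _ hq1 _ hq2 h).trans (by gcongr; exact le_abs_self _)
    · rw [dist_comm]
      exact (h3 _ hq2 _ hq1 h).trans (by gcongr; exact le_abs_self _)
  rw [mem_iInter] at hfT
  have hlip : ∀ a a', dist (f a) (f a') ≤ L * |(a : ℝ) - a'| := fun a a' => (hfT (a, a')).1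
  have hfx : ∀ a, dist x (f a) ≤ L * a := fun a => (hfT (a, a)).2.1
  have hfy : ∀ a, dist (f a) y ≤ L * (1 - a) := fun a => (hfT (a, a)).2.2
  have h0 : f 0 = x := (dist_le_zero.1 (by simpa using hfx 0)).symm
  have h1 : f 1 = y := dist_le_zero.1 (by simpa using hfy 1)
  have hle : ∀ a a' : unitInterval, a ≤ a' → dist (f a) (f a') = |(a : ℝ) - a'| * L := by
    intro a a' h
    refine le_antisymm ((hlip a a').trans_eq (mul_comm _ _)) ?_
    rw [abs_sub_comm, abs_of_nonneg (sub_nonneg.2 (Subtype.coe_le_coe.2 h))]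
    linarith [dist_triangle4 x (f a) (f a') y, hfx a, hfy a']
  have hcont : Continuous f :=
    (LipschitzWith.of_dist_le_mul (K := ⟨L, hL⟩) fun a a' => hlip a a').continuous
  refine ⟨⟨⟨f, hcont⟩, fun a a' => ?_⟩, h0, h1, fun a => (hfS a (mem_univ _)).1⟩
  change dist (f a) (f a') = _ * dist (f 0) (f 1)
  rw [h0, h1]
  rcases le_total a a' with h | h
  · exact hle a a' h
  · rw [dist_comm, abs_sub_comm]
    exact hle a' a h

end Geodesics

/-- `(supp m, d)` is a proper geodesic metric space. -/
theorem proper_geodesic_space {X : Type*} [MetricSpace X] [MeasurableSpace X]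
    [BorelSpace X] [CompleteSpace X] [TopologicalSpace.SeparableSpace X]
    (m : Measure X) (hm : FiniteOnBounded m) (G : X → X → ℝ≥0∞)
    (s : ℝ → ℝ) (N : ℝ) (hsN : DistortionData s N)
    (hMCP : MCP m G (beta s N))
    (hyp : (∀ S : Set X, S ⊆ mSupp m → Bornology.IsBounded S → diamG m G S < ⊤) ∨
      (∀ t ∈ Set.Icc (0:ℝ) 1, Monotone (beta s N t))) :
    (∀ K : Set X, K ⊆ mSupp m → IsClosed K → Bornology.IsBounded K → IsCompact K) ∧
      GeodesicSupp m := by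
  have : SecondCountableTopology X := UniformSpace.secondCountable_of_separable X
  have hcomp : ∀ K : Set X, K ⊆ mSupp m → IsClosed K → Bornology.IsBounded K → IsCompact K :=
    fun K hK hKc hKb => hMCP.isCompact_of_isClosed_isBounded hm hsN hyp hK hKc hKb
  refine ⟨hcomp, fun x hx y hy => ?_⟩
  obtain ⟨γ, h0, h1, hγ⟩ := exists_geoSpace_of_exists_intermediate
    (fun z r => hcomp _ inter_subset_left ((isClosed_mSupp m).inter isClosed_closedBall)
      (isBounded_closedBall.subset inter_subset_right))
    (fun _ hx' _ hy' _ ht => hMCP.exists_intermediate hm hsN hyp hx' hy' ht) hx hy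
  exact ⟨γ, by simpa [geval] using h0, by simpa [geval] using h1, fun t _ => hγ _⟩

end GMMS
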